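/- Let V be an infinite-dimensional vector space over a field F, and let α > ℵ₀ be a cardinal with α ≤ dim_F V. Then every Lie ideal U of gl(V) whose associated associative ideal generated by [U,U] equals I_α must be either I_α or F·Id_V + I_α. -/

import Mathlib

open Cardinal

variable (F V : Type*) [Field F] [AddCommGroup V] [Module F V]

/-- The ideal `I_α` of endomorphisms of rank `< α` (for an infinite cardinal `α`),
as a subspace of `End F V`. -/
def rankIdeal (α : Cardinal) (hα : ℵ₀ ≤ α) : Submodule F (Module.End F V) where
  carrier := {φ | LinearMap.rank φ < α}
  zero_mem' := by
    simp only [Set.mem_setOf_eq, LinearMap.rank_zero]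
    exact lt_of_lt_of_le aleph0_pos hα
  add_mem' := fun hf hg =>
    lt_of_le_of_lt (LinearMap.rank_add_le _ _) (Cardinal.add_lt_of_lt hα hf hg)
  smul_mem' := by
    intro c f hf
    have h1 : LinearMap.range (c • f) ≤ LinearMap.range f := by
      rintro x ⟨y, rfl⟩
      exact ⟨c • y, by simp⟩
    exact lt_of_le_of_lt (Submodule.rank_mono h1) hf

/-- Herstein: the ideal generated by `[U,U]` satisfies `[J, A] ⊆ U`. -/
theorem aux_herstein {K A : Type*} [Field K] [Ring A] [Algebra K A] (U : Submodule K A)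
    (hU : ∀ u ∈ U, ∀ a : A, u * a - a * u ∈ U) (x : A)
    (hx : x ∈ TwoSidedIdeal.span {y : A | ∃ u ∈ U, ∃ u' ∈ U, y = u * u' - u' * u}) (a : A) :
    x * a - a * x ∈ U := by
  let T : A → Prop := fun x => ∀ a, x * a - a * x ∈ U
  have hUT : ∀ u ∈ U, T u := hU
  have hTmul : ∀ x y, T x → T y → T (x * y) := by
    intro x y hx hy a
    have := U.add_mem (hx (y * a)) (hy (a * x))
    convert this using 1
    noncomm_ring
  have hTsub : ∀ x y, T x → T y → T (x - y) := by
    intro x y hx hy a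
    have := U.sub_mem (hx a) (hy a)
    convert this using 1
    noncomm_ring
  have h1 : ∀ u ∈ U, ∀ v ∈ U, ∀ x, T ((u * v - v * u) * x) := by
    intro u hu v hv x
    have e : (u * v - v * u) * x = (u * (v * x) - (v * x) * u) - v * (u * x - x * u) := by
      noncomm_ring
    rw [e]
    exact hTsub _ _ (hUT _ (hU u hu _)) (hTmul _ _ (hUT v hv) (hUT _ (hU u hu _)))
  have h2 : ∀ u ∈ U, ∀ v ∈ U, ∀ b c, T (b * (u * v - v * u) * c) := by
    intro u hu v hv b c
    have e : b * (u * v - v * u) * c = (u * v - v * u) * (c * b)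
        - (((u * v - v * u) * c) * b - b * ((u * v - v * u) * c)) := by
      noncomm_ring
    rw [e]
    exact hTsub _ _ (h1 u hu v hv _) (hUT _ (h1 u hu v hv c b))
  have key : ∀ b c, T (b * x * c) := by
    induction hx using TwoSidedIdeal.span_induction with
    | mem x h =>
      obtain ⟨u, hu, v, hv, rfl⟩ := h
      exact h2 u hu v hv
    | zero => intro b c a; simp
    | add x y _ _ ihx ihy =>
      intro b c a
      have := U.add_mem (ihx b c a) (ihy b c a)
      convert this using 1
      noncomm_ring
    | neg x _ ih =>
      intro b c a
      have := U.neg_mem (ih b c a)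
      convert this using 1
      noncomm_ring
    | left_absorb d x _ ih =>
      intro b c
      have := ih (b * d) c
      simpa only [mul_assoc] using this
    | right_absorb d x _ ih =>
      intro b c
      have := ih b (d * c)
      simpa only [mul_assoc] using this
  have := key 1 1 a
  simpa using this

/-- The commutator identity on `ℕ →₀ W`. -/
theorem aux_shift {K W : Type*} [Field K] [AddCommGroup W] [Module K W] (ψ : W →ₗ[K] W) :
    ∃ X S : (ℕ →₀ W) →ₗ[K] (ℕ →₀ W),
      X ∘ₗ S - S ∘ₗ X = Finsupp.lsingle 0 ∘ₗ ψ ∘ₗ Finsupp.lapply 0 := by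
  let M : (ℕ →₀ W) →ₗ[K] (ℕ →₀ W) := Finsupp.mapRange.linearMap ψ
  let t : (ℕ →₀ W) →ₗ[K] (ℕ →₀ W) := Finsupp.lcomapDomain Nat.succ Nat.succ_injective
  let s : (ℕ →₀ W) →ₗ[K] (ℕ →₀ W) := Finsupp.lmapDomain W K Nat.succ
  have ht : ∀ f n, t f n = f (n + 1) := fun f n => rfl
  have hM : ∀ f n, M f n = ψ (f n) := fun f n => by simp [M]
  have hs : ∀ f n, s f (n + 1) = f n := fun f n =>
    Finsupp.mapDomain_apply Nat.succ_injective f n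
  have hs0 : ∀ f, s f 0 = 0 := fun f =>
    Finsupp.mapDomain_notin_range f 0 (by simp)
  refine ⟨M ∘ₗ t, s, ?_⟩
  refine LinearMap.ext fun f => Finsupp.ext fun n => ?_
  cases n with
  | zero =>
    simp only [LinearMap.sub_apply, LinearMap.comp_apply, Finsupp.sub_apply, ht, hM, hs, hs0]
    simp
  | succ n =>
    simp only [LinearMap.sub_apply, LinearMap.comp_apply, Finsupp.sub_apply, ht, hM, hs]
    simp

/-- Every element of rank `< α` is a sum of commutators `[x,a]`, with `x` of rank `< α`. -/
theorem aux_perfect {K : Type*} {E : Type*} [Field K] [AddCommGroup E] [Module K E]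
    (α : Cardinal) (hα : ℵ₀ < α) (hα' : α ≤ Module.rank K E)
    (U : Submodule K (Module.End K E))
    (hU : ∀ x : Module.End K E, LinearMap.rank x < α → ∀ a, x * a - a * x ∈ U)
    (φ : Module.End K E) (hφ : LinearMap.rank φ < α) : φ ∈ U := by
  let W := LinearMap.range φ
  have hW : Module.rank K W < α := hφ
  have hN : Module.rank K (ℕ →₀ W) < α := by
    rw [rank_finsupp]
    simpa using Cardinal.mul_lt_of_lt hα.le hα hW
  obtain ⟨i, hi⟩ := rank_le_iff_exists_linearMap.1 (hN.le.trans hα')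
  obtain ⟨r, hr⟩ := LinearMap.exists_leftInverse_of_injective i (LinearMap.ker_eq_bot.2 hi)
  have hr' : ∀ z, r (i z) = z := fun z => LinearMap.congr_fun hr z
  let f : W →ₗ[K] E := W.subtype
  let g : E →ₗ[K] W := φ.rangeRestrict
  obtain ⟨X, S, hXS⟩ := aux_shift (g ∘ₗ f)
  let j0 : W →ₗ[K] E := i ∘ₗ Finsupp.lsingle 0
  let q0 : E →ₗ[K] W := Finsupp.lapply 0 ∘ₗ r
  have e1 : φ = ((f ∘ₗ q0 : Module.End K E) * (j0 ∘ₗ g : Module.End K E)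
        - (j0 ∘ₗ g : Module.End K E) * (f ∘ₗ q0 : Module.End K E))
      + ((i ∘ₗ X ∘ₗ r : Module.End K E) * (i ∘ₗ S ∘ₗ r : Module.End K E)
        - (i ∘ₗ S ∘ₗ r : Module.End K E) * (i ∘ₗ X ∘ₗ r : Module.End K E)) := by
    refine LinearMap.ext fun v => ?_
    have h := LinearMap.congr_fun hXS (r v)
    simp only [LinearMap.sub_apply, LinearMap.comp_apply] at h
    simp only [LinearMap.add_apply, LinearMap.sub_apply, Module.End.mul_apply,
      LinearMap.comp_apply, hr', j0, q0]
    rw [← map_sub i, h]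
    simp [f, g]
  rw [e1]
  refine U.add_mem (hU _ ?_ _) (hU _ ?_ _)
  · exact ((LinearMap.rank_comp_le_left _ _).trans (LinearMap.rank_le_domain f)).trans_lt hW
  · exact ((LinearMap.rank_comp_le_left _ _).trans (LinearMap.rank_le_domain i)).trans_lt hN

/-- von Neumann regularity. -/
theorem aux_regular {K : Type*} {E : Type*} [Field K] [AddCommGroup E] [Module K E]
    (b : Module.End K E) : ∃ z : Module.End K E, b * z * b = b := by
  obtain ⟨s, hs⟩ := b.rangeRestrict.exists_rightInverse_of_surjective b.range_rangeRestrict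
  obtain ⟨p, hp⟩ := LinearMap.exists_leftInverse_of_injective (LinearMap.range b).subtype
    (Submodule.ker_subtype _)
  refine ⟨s ∘ₗ p, LinearMap.ext fun v => ?_⟩
  have h1 : p (b v) = b.rangeRestrict v := LinearMap.congr_fun hp (b.rangeRestrict v)
  have h2 : b.rangeRestrict (s (b.rangeRestrict v)) = b.rangeRestrict v :=
    LinearMap.congr_fun hs _
  have h3 := congrArg Subtype.val h2
  simpa [Module.End.mul_apply, h1] using h3

/-- The centre of `End E / I_α` consists of scalars. -/
theorem aux_center {K : Type*} {E : Type*} [Field K] [AddCommGroup E] [Module K E]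
    (α : Cardinal) (hα : ℵ₀ < α) (u : Module.End K E)
    (hu : ∀ z : Module.End K E, LinearMap.rank (u * z - z * u) < α) :
    ∃ c : K, LinearMap.rank (u - c • (1 : Module.End K E)) < α := by
  let P : Set (Submodule K E) := {X | ∀ x ∈ X, ∀ y ∈ X, x + u y = 0 → x = 0 ∧ y = 0}
  obtain ⟨X, hX⟩ : ∃ X, Maximal (· ∈ P) X := by
    refine zorn_le₀ P fun c hc hch => ?_
    rcases c.eq_empty_or_nonempty with rfl | hne
    · refine ⟨⊥, ?_, by simp⟩
      intro x hx y hy _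
      exact ⟨by simpa using hx, by simpa using hy⟩
    · refine ⟨sSup c, ?_, fun z hz => le_sSup hz⟩
      intro x hx y hy h
      rw [Submodule.mem_sSup_of_directed hne hch.directedOn] at hx hy
      obtain ⟨A, hA, hxA⟩ := hx
      obtain ⟨B, hB, hyB⟩ := hy
      rcases hch.total hA hB with hAB | hAB
      · exact hc hB x (hAB hxA) y hyB h
      · exact hc hA x hxA y (hAB hyB) h
  have hXP : ∀ x ∈ X, ∀ y ∈ X, x + u y = 0 → x = 0 ∧ y = 0 := hX.1
  have hXr : Module.rank K X < α := by
    let m : (X × X) →ₗ[K] E := X.subtype.coprod (u ∘ₗ X.subtype)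
    have hm : LinearMap.ker m = ⊥ := by
      rw [LinearMap.ker_eq_bot']
      rintro ⟨x, y⟩ h
      have h' : (x : E) + u y = 0 := by simpa [m] using h
      obtain ⟨h1, h2⟩ := hXP x x.2 y y.2 h'
      ext <;> simp [h1, h2]
    obtain ⟨g, hg⟩ := LinearMap.exists_leftInverse_of_injective m hm
    let z : Module.End K E := X.subtype ∘ₗ LinearMap.snd K X X ∘ₗ g
    have hz1 : ∀ x : X, z x = 0 := by
      intro x
      have := LinearMap.congr_fun hg (x, 0)
      simp [m] at this
      simp [z, this]
    have hz2 : ∀ x : X, z (u x) = x := by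
      intro x
      have := LinearMap.congr_fun hg (0, x)
      simp [m] at this
      simp [z, this]
    refine lt_of_le_of_lt (Submodule.rank_mono ?_) (hu z)
    intro x hx
    refine ⟨-x, ?_⟩
    have a1 := hz1 ⟨x, hx⟩
    have a2 := hz2 ⟨x, hx⟩
    simp only at a1 a2
    simp [Module.End.mul_apply, a1, a2]
  let W := X ⊔ X.map u
  have hWr : Module.rank K W < α := by
    refine lt_of_le_of_lt (Submodule.rank_add_le_rank_add_rank _ _) ?_
    exact Cardinal.add_lt_of_lt hα.le hXr ((rank_map_le u X).trans_lt hXr)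
  have hdep : ∀ v : E, ∃ a b : K, (a ≠ 0 ∨ b ≠ 0) ∧ a • v + b • u v ∈ W := by
    intro v
    by_cases hv : v ∈ W
    · exact ⟨1, 0, by simp, by simpa using hv⟩
    have hnP : X ⊔ Submodule.span K {v} ∉ P := by
      intro h
      have := hX.2 h le_sup_left
      exact hv (Submodule.mem_sup_left (this (Submodule.mem_sup_right
        (Submodule.mem_span_singleton_self v))))
    simp only [P, Set.mem_setOf_eq, not_forall] at hnP
    obtain ⟨x, hx, y, hy, h, hne⟩ := hnP
    obtain ⟨x', hx', w, hw, rfl⟩ := Submodule.mem_sup.1 hx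
    obtain ⟨a, rfl⟩ := Submodule.mem_span_singleton.1 hw
    obtain ⟨y', hy', w', hw', rfl⟩ := Submodule.mem_sup.1 hy
    obtain ⟨b, rfl⟩ := Submodule.mem_span_singleton.1 hw'
    refine ⟨a, b, ?_, ?_⟩
    · by_contra! hab
      obtain ⟨rfl, rfl⟩ := hab
      simp only [zero_smul, add_zero] at h hne
      exact hne (hXP _ hx' _ hy' h)
    · have e : a • v + b • u v = -(x' + u y') := by
        rw [map_add, map_smul] at h
        rw [eq_neg_iff_add_eq_zero, ← h]
        abel
      rw [e]
      exact W.neg_mem (W.add_mem (Submodule.mem_sup_left hx')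
        (Submodule.mem_sup_right (Submodule.mem_map_of_mem hy')))
  obtain ⟨σ, hσ⟩ := W.mkQ.exists_rightInverse_of_surjective W.range_mkQ
  have hσ' : ∀ q, W.mkQ (σ q) = q := fun q => LinearMap.congr_fun hσ q
  let T : (E ⧸ W) →ₗ[K] (E ⧸ W) := W.mkQ ∘ₗ u ∘ₗ σ
  obtain ⟨c, hc⟩ : ∃ c : K, T = c • 1 := by
    apply LinearMap.exists_eq_smul_id_of_forall_notLinearIndependent
    intro q hq
    obtain ⟨a, b, hab, h⟩ := hdep (σ q)
    have h' : a • q + b • T q = 0 := by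
      have := (Submodule.Quotient.mk_eq_zero W).2 h
      rw [← Submodule.mkQ_apply, map_add, map_smul, map_smul, hσ'] at this
      exact this
    have := LinearIndependent.pair_iff.1 hq a b h'
    tauto
  refine ⟨c, ?_⟩
  have hfin : ∀ f : Module.End K E, (∀ v, f v ∈ W) → LinearMap.rank f < α := by
    intro f hf
    refine lt_of_le_of_lt (Submodule.rank_mono ?_) hWr
    rintro _ ⟨v, rfl⟩
    exact hf v
  let π : Module.End K E := σ ∘ₗ W.mkQ
  have e : u - c • (1 : Module.End K E) = (u - c • (1 : Module.End K E)) * (1 - π)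
      + (u - c • (1 : Module.End K E)) * π := by
    rw [← mul_add]; simp
  rw [e]
  refine (LinearMap.rank_add_le _ _).trans_lt (Cardinal.add_lt_of_lt hα.le ?_ ?_)
  · refine (LinearMap.rank_comp_le_right _ _).trans_lt (hfin _ fun v => ?_)
    rw [← Submodule.Quotient.mk_eq_zero, ← Submodule.mkQ_apply]
    simp only [LinearMap.sub_apply, map_sub, π, LinearMap.comp_apply, hσ', Module.End.one_apply,
      sub_self]
  · refine hfin _ fun v => ?_
    rw [← Submodule.Quotient.mk_eq_zero, ← Submodule.mkQ_apply]
    have h := LinearMap.congr_fun hc (W.mkQ v)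
    simp only [T, LinearMap.comp_apply, LinearMap.smul_apply, Module.End.one_apply] at h
    simp only [LinearMap.sub_apply, map_sub, π, LinearMap.comp_apply, hσ', Module.End.one_apply,
      Module.End.mul_apply, LinearMap.smul_apply, map_smul, h, sub_self]

/-- If `[U,U] ⊆ I_α` then `[U, End E] ⊆ I_α`. -/
theorem aux_comm {K : Type*} {E : Type*} [Field K] [AddCommGroup E] [Module K E]
    (h2 : (2 : K) ≠ 0) (I U : Submodule K (Module.End K E))
    (hl : ∀ a, ∀ x ∈ I, a * x ∈ I) (hr : ∀ a, ∀ x ∈ I, x * a ∈ I)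
    (hU : ∀ u ∈ U, ∀ a : Module.End K E, u * a - a * u ∈ U)
    (hUU : ∀ u ∈ U, ∀ v ∈ U, u * v - v * u ∈ I) (u : Module.End K E) (hu : u ∈ U)
    (x : Module.End K E) : u * x - x * u ∈ I := by
  let d : Module.End K E → Module.End K E := fun x => u * x - x * u
  have hd2 : ∀ x, d (d x) ∈ I := fun x => hUU u hu _ (hU u hu x)
  have hdd : ∀ x y, d x * d y ∈ I := by
    intro x y
    have e : (2 : K) • (d x * d y) = d (d (x * y)) - d (d x) * y - x * d (d y) := by
      rw [two_smul]
      simp only [d]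
      noncomm_ring
    have : (2 : K) • (d x * d y) ∈ I := by
      rw [e]
      exact I.sub_mem (I.sub_mem (hd2 _) (hr _ _ (hd2 _))) (hl _ _ (hd2 _))
    exact (I.smul_mem_iff h2).1 this
  have hdzd : ∀ z, d x * z * d x ∈ I := by
    intro z
    have e : d x * z * d x = d x * d (z * x) - (d x * d z) * x := by
      simp only [d]
      noncomm_ring
    rw [e]
    exact I.sub_mem (hdd _ _) (hr _ _ (hdd _ _))
  obtain ⟨z, hz⟩ := aux_regular (d x)
  have := hdzd z
  rw [hz] at this
  exact this

/-- For `ℵ₀ < α ≤ dim V`, any Lie ideal of `gl(V)` whose generated associative ideal of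
commutators is `I_α` equals `I_α` or `F·Id + I_α`. -/
theorem lie_ideal_of_large_rank (h2 : (2 : F) ≠ 0) (hV : ℵ₀ ≤ Module.rank F V)
    (α : Cardinal) (hα : ℵ₀ < α) (hα' : α ≤ Module.rank F V)
    (U : Submodule F (Module.End F V))
    (hU : ∀ u ∈ U, ∀ a : Module.End F V, u * a - a * u ∈ U)
    (hid : (TwoSidedIdeal.span {y : Module.End F V | ∃ u ∈ U, ∃ u' ∈ U, y = u * u' - u' * u} :
        Set (Module.End F V)) = {φ : Module.End F V | LinearMap.rank φ < α}) :
    U = rankIdeal F V α hα.le ∨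
      U = Submodule.span F {(1 : Module.End F V)} ⊔ rankIdeal F V α hα.le := by
  have hl : ∀ a, ∀ x ∈ rankIdeal F V α hα.le, a * x ∈ rankIdeal F V α hα.le :=
    fun a x hx => (LinearMap.rank_comp_le_right x a).trans_lt hx
  have hr : ∀ a, ∀ x ∈ rankIdeal F V α hα.le, x * a ∈ rankIdeal F V α hα.le :=
    fun a x hx => (LinearMap.rank_comp_le_left a x).trans_lt hx
  have hUU : ∀ u ∈ U, ∀ v ∈ U, u * v - v * u ∈ rankIdeal F V α hα.le := by
    intro u hu v hv
    have : u * v - v * u ∈ {φ : Module.End F V | LinearMap.rank φ < α} := by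
      rw [← hid]
      exact TwoSidedIdeal.subset_span ⟨u, hu, v, hv, rfl⟩
    exact this
  have hIU : rankIdeal F V α hα.le ≤ U := by
    intro φ hφ
    refine aux_perfect α hα hα' U ?_ φ hφ
    intro x hx a
    refine aux_herstein U hU x ?_ a
    have : x ∈ {φ : Module.End F V | LinearMap.rank φ < α} := hx
    rw [← hid] at this
    exact this
  have hsc : ∀ u ∈ U, ∃ c : F, u - c • (1 : Module.End F V) ∈ rankIdeal F V α hα.le :=
    fun u hu => aux_center α hα u (aux_comm h2 _ U hl hr hU hUU u hu)
  have hle : U ≤ Submodule.span F {(1 : Module.End F V)} ⊔ rankIdeal F V α hα.le := by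
    intro u hu
    obtain ⟨c, hc⟩ := hsc u hu
    exact Submodule.mem_sup.2 ⟨c • 1, Submodule.mem_span_singleton.2 ⟨c, rfl⟩, _, hc, by abel⟩
  by_cases h : U ≤ rankIdeal F V α hα.le
  · exact Or.inl (le_antisymm h hIU)
  · right
    refine le_antisymm hle (sup_le ?_ hIU)
    obtain ⟨u, hu, hun⟩ := SetLike.not_le_iff_exists.1 h
    obtain ⟨c, hc⟩ := hsc u hu
    have hc0 : c ≠ 0 := by
      rintro rfl
      exact hun (by simpa using hc)
    rw [Submodule.span_singleton_le_iff_mem]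
    have h1 : c • (1 : Module.End F V) ∈ U := by
      have := U.sub_mem hu (hIU hc)
      simpa using this
    exact (U.smul_mem_iff hc0).1 h1
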